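/- Let R6 be the rotation by π/3 about (0,0), R3 the rotation by 2π/3 about (2,0), and β₀ the reflection across the x-axis, all in Isom(ℝ²). The group homomorphism from the presented group ⟨α, β, γ | α², β², γ², (αβ)⁶, (βγ)³, (αγ)²⟩ to Isom(ℝ²) determined by α ↦ R6⁻¹∘β₀, β ↦ β₀, γ ↦ R3∘β₀ is well defined (the images satisfy the relations) and injective, with image the subgroup ⟨R6, R3, β₀⟩ of Isom(ℝ²); consequently the symmetry group of the Semikitegrid is isomorphic to this Coxeter group. -/

import Mathlib

open MeasureTheory Complex

noncomputable section

/-- The group of isometries of the euclidean plane, identified with `ℂ`. -/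
abbrev IsomC := ℂ ≃ᵢ ℂ

/-- The rotation of angle `θ` about the point `c`. -/
noncomputable def rotAbout (θ : ℝ) (c : ℂ) : IsomC :=
  (IsometryEquiv.addLeft (-c)).trans
    ((rotation (Circle.exp θ)).toIsometryEquiv.trans (IsometryEquiv.addLeft c))

/-- `R6`: rotation by `π/3` about the origin. -/
noncomputable def R6 : IsomC := rotAbout (Real.pi / 3) 0
/-- `R3`: rotation by `2π/3` about `(2,0)`. -/
noncomputable def R3 : IsomC := rotAbout (2 * Real.pi / 3) 2
/-- `β₀`: the reflection across the x-axis, i.e. complex conjugation. -/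
noncomputable def reflX : IsomC := Complex.conjLIE.toIsometryEquiv

/-- The Coxeter relations `α², β², γ², (αβ)⁶, (βγ)³, (αγ)²`. -/
def kitegridRels : Set (FreeGroup (Fin 3)) :=
  {(FreeGroup.of 0) ^ 2, (FreeGroup.of 1) ^ 2, (FreeGroup.of 2) ^ 2,
   (FreeGroup.of 0 * FreeGroup.of 1) ^ 6, (FreeGroup.of 1 * FreeGroup.of 2) ^ 3,
   (FreeGroup.of 0 * FreeGroup.of 2) ^ 2}

/-- The abstract Coxeter group `⟨α, β, γ | α², β², γ², (αβ)⁶, (βγ)³, (αγ)²⟩`. -/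
abbrev CoxGroup := PresentedGroup kitegridRels

section NormalForm

variable {G : Type*} [Group G]

/-- In a group generated by involutions `a, b, c` subject to the Coxeter relations of type affine `G₂`,
every element is a word in the commuting translations `u = c b (a b)²` and `v = (a b) u (a b)⁻¹`
followed by an element of the dihedral group generated by `a` and `b`. -/
theorem exists_normalForm {a b c : G} (ha : a ^ 2 = 1) (hb : b ^ 2 = 1) (hc : c ^ 2 = 1)
    (hab : (a * b) ^ 6 = 1) (hbc : (b * c) ^ 3 = 1) (hac : (a * c) ^ 2 = 1)
    {g : G} (hg : g ∈ Subgroup.closure {a, b, c}) :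
    ∃ (m n k : ℤ) (d : G), (d = 1 ∨ d = b) ∧
      g = (c * b * (a * b) ^ 2) ^ m * (a * b * (c * b) * (a * b)) ^ n * (a * b) ^ k * d := by
  have ha' : a⁻¹ = a := inv_eq_of_mul_eq_one_left (by rw [← sq, ha])
  have hb' : b⁻¹ = b := inv_eq_of_mul_eq_one_left (by rw [← sq, hb])
  have hc' : c⁻¹ = c := inv_eq_of_mul_eq_one_left (by rw [← sq, hc])
  obtain ⟨r, hr⟩ : ∃ r, r = a * b := ⟨_, rfl⟩
  obtain ⟨s, hs⟩ : ∃ s, s = c * b := ⟨_, rfl⟩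
  have har : a = r * b := by rw [hr, mul_assoc, ← sq, hb, mul_one]
  have hcs : c = s * b := by rw [hs, mul_assoc, ← sq, hb, mul_one]
  have hs' : s⁻¹ = b * c := by rw [hs, mul_inv_rev, hb', hc']
  have hs3 : s⁻¹ * s⁻¹ = s := by
    rw [← hs'] at hbc
    exact mul_eq_one_iff_eq_inv.mp (by rwa [pow_succ, sq] at hbc) |>.trans (inv_inv s)
  have hac' : a * c = r * s⁻¹ := by rw [hs', hr, mul_assoc, ← mul_assoc b b, ← sq, hb, one_mul]
  have hrs : r * s⁻¹ * r = s := by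
    rw [hac', sq, ← mul_assoc] at hac
    simpa using mul_eq_one_iff_eq_inv.mp hac
  have hsr : s * r⁻¹ = r * s⁻¹ := by rw [mul_inv_eq_iff_eq_mul, hrs]
  have hrs' : r⁻¹ * s = s⁻¹ * r := by rw [inv_mul_eq_iff_eq_mul, ← mul_assoc, hrs]
  have hbr : SemiconjBy b r r⁻¹ := by
    simp only [SemiconjBy, hr, mul_inv_rev, ha', hb', mul_assoc]
  have hbs : SemiconjBy b s s⁻¹ := by
    simp only [SemiconjBy, hs, mul_inv_rev, hc', hb', mul_assoc]
  rw [← hr, ← hs]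
  obtain ⟨u, hu⟩ : ∃ u, u = s * r ^ 2 := ⟨_, rfl⟩
  obtain ⟨v, hv⟩ : ∃ v, v = r * s * r := ⟨_, rfl⟩
  rw [← hu, ← hv]
  have hr4 : r ^ 4 = r⁻¹ * r⁻¹ := by
    rw [← mul_inv_rev, ← sq, eq_inv_iff_mul_eq_one, ← pow_add, hr, hab]
  have htu : r ^ 2 * s * u = v := by
    calc r ^ 2 * s * u = r * (r * (s * s) * r) * r := by rw [hu]; simp only [sq, mul_assoc]
      _ = r * (r * s⁻¹ * r) * r := by
        rw [show s * s = s⁻¹ by rw [← inv_inj, mul_inv_rev, hs3, inv_inv]]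
      _ = v := by rw [hrs, hv]
  have hut : u * (r ^ 2 * s) = v := by
    calc u * (r ^ 2 * s) = s * r ^ 4 * s := by rw [hu, pow_add r 2 2]; simp only [mul_assoc]
      _ = s * r⁻¹ * (r⁻¹ * s) := by rw [hr4]; simp only [mul_assoc]
      _ = r * (s⁻¹ * s⁻¹) * r := by rw [hsr, hrs']; simp only [mul_assoc]
      _ = v := by rw [hs3, hv]
  have ht : r ^ 2 * s = v * u⁻¹ := by rw [← htu, mul_inv_cancel_right]
  have huv : Commute u v := by
    have h : u * (v * u⁻¹) = v := by rw [← ht, hut]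
    rw [← mul_assoc, mul_inv_eq_iff_eq_mul] at h
    exact h
  have hru : SemiconjBy r u v := by
    rw [SemiconjBy, hu, hv]; simp only [sq, mul_assoc]
  have hrv : SemiconjBy r v (v * u⁻¹) := by
    rw [SemiconjBy, ← ht, hv]; simp only [sq, mul_assoc]
  have hbu : SemiconjBy b u (u * v⁻¹) := by
    have h : SemiconjBy b (s * r ^ 2) (s⁻¹ * r⁻¹ ^ 2) := hbs.mul_right (hbr.pow_right 2)
    rwa [← hu, show s⁻¹ * r⁻¹ ^ 2 = (r ^ 2 * s)⁻¹ by rw [mul_inv_rev, inv_pow], ht,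
      mul_inv_rev, inv_inv] at h
  have hbv : SemiconjBy b v v⁻¹ := by
    have h := (hbr.mul_right hbs).mul_right hbr
    rwa [← hv, show r⁻¹ * s⁻¹ * r⁻¹ = v⁻¹ by rw [hv]; simp only [mul_inv_rev, mul_assoc]] at h
  let P : G → Prop := fun g ↦
    ∃ (m n k : ℤ) (d : G), (d = 1 ∨ d = b) ∧ g = u ^ m * v ^ n * r ^ k * d
  have hPu (g : G) (hg : P g) : P (u * g) := by
    obtain ⟨m, n, k, d, hd, rfl⟩ := hg
    exact ⟨m + 1, n, k, d, hd, by simp only [add_comm m, zpow_one_add, mul_assoc]⟩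
  have hPr (g : G) (hg : P g) : P (r * g) := by
    obtain ⟨m, n, k, d, hd, rfl⟩ := hg
    refine ⟨-n, m + n, 1 + k, d, hd, ?_⟩
    have h := (hru.zpow_right m).mul_right (hrv.zpow_right n)
    calc r * (u ^ m * v ^ n * r ^ k * d) = r * (u ^ m * v ^ n) * r ^ k * d := by
          simp only [mul_assoc]
      _ = v ^ m * (v * u⁻¹) ^ n * r * r ^ k * d := by rw [h.eq]
      _ = u ^ (-n) * v ^ (m + n) * r ^ (1 + k) * d := by
        rw [huv.symm.inv_right.mul_zpow, inv_zpow', ← mul_assoc (v ^ m), ← zpow_add,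
          (huv.symm.zpow_zpow (m + n) (-n)).eq, zpow_one_add]
        simp only [mul_assoc]
  have hPb (g : G) (hg : P g) : P (b * g) := by
    obtain ⟨m, n, k, d, hd, rfl⟩ := hg
    refine ⟨m, -m - n, -k, b * d, ?_, ?_⟩
    · rcases hd with rfl | rfl
      · simp
      · simp [← sq, hb]
    have h := ((hbu.zpow_right m).mul_right (hbv.zpow_right n)).mul_right (hbr.zpow_right k)
    calc b * (u ^ m * v ^ n * r ^ k * d) = b * (u ^ m * v ^ n * r ^ k) * d := by
          simp only [mul_assoc]
      _ = (u * v⁻¹) ^ m * v⁻¹ ^ n * r⁻¹ ^ k * b * d := by rw [h.eq]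
      _ = u ^ m * v ^ (-m - n) * r ^ (-k) * (b * d) := by
        rw [huv.inv_right.mul_zpow, inv_zpow', inv_zpow', inv_zpow', sub_eq_add_neg, zpow_add]
        simp only [mul_assoc]
  have hPa (g : G) (hg : P g) : P (a * g) := by
    rw [har, mul_assoc]; exact hPr _ (hPb _ hg)
  have hPc (g : G) (hg : P g) : P (c * g) := by
    have hc4 : c = u * (r * (r * (r * (r * b)))) := by
      have h : u * r ^ 4 = s := by rw [hr4, hu, sq]; group
      rw [hcs, ← h]; simp only [pow_succ, pow_zero, one_mul, mul_assoc]
    rw [hc4]; simp only [mul_assoc]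
    exact hPu _ (hPr _ (hPr _ (hPr _ (hPr _ (hPb _ hg)))))
  have hPmul (x : G) (hx : x ∈ ({a, b, c} : Set G)) (y : G) (hy : P y) : P (x * y) := by
    rcases hx with rfl | rfl | rfl
    exacts [hPa y hy, hPb y hy, hPc y hy]
  have hinv (x : G) (hx : x ∈ ({a, b, c} : Set G)) : x⁻¹ = x := by
    rcases hx with rfl | rfl | rfl <;> assumption
  change P g
  induction hg using Subgroup.closure_induction_left with
  | one => exact ⟨0, 0, 0, 1, Or.inl rfl, by simp⟩
  | mul_left x hx y _ hy => exact hPmul x hx y hy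
  | inv_mul_cancel x hx y _ hy => rw [hinv x hx]; exact hPmul x hx y hy

end NormalForm

section PlaneIsometries

theorem IsometryEquiv.zpow_apply_of_add {e : IsomC} {w : ℂ} (he : ∀ z, e z = w + z)
    (m : ℤ) (z : ℂ) : (e ^ m) z = m * w + z := by
  induction m generalizing z with
  | zero => simp
  | succ n ih => rw [zpow_add_one, IsometryEquiv.mul_apply, he, ih]; push_cast; ring
  | pred n ih =>
    have h : e⁻¹ z = z - w := by
      apply e.injective; rw [IsometryEquiv.apply_inv_self, he]; ring
    rw [zpow_sub_one, IsometryEquiv.mul_apply, h, ih]; push_cast; ring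

theorem IsometryEquiv.zpow_apply_of_mul {e : IsomC} {w : ℂ} (hw : w ≠ 0) (he : ∀ z, e z = w * z)
    (m : ℤ) (z : ℂ) : (e ^ m) z = w ^ m * z := by
  induction m generalizing z with
  | zero => simp
  | succ n ih => rw [zpow_add_one, IsometryEquiv.mul_apply, he, ih, zpow_add_one₀ hw, mul_assoc]
  | pred n ih =>
    have h : e⁻¹ z = w⁻¹ * z := by
      apply e.injective; rw [IsometryEquiv.apply_inv_self, he, mul_inv_cancel_left₀ hw]
    rw [zpow_sub_one, IsometryEquiv.mul_apply, h, ih, zpow_sub_one₀ hw, mul_assoc]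

/-- The primitive sixth root of unity `exp (2πi / 6)`. -/
def sixthRoot : ℂ := exp (2 * Real.pi * I / (6 : ℕ))

theorem isPrimitiveRoot_sixthRoot : IsPrimitiveRoot sixthRoot 6 :=
  Complex.isPrimitiveRoot_exp 6 (by norm_num)

theorem sixthRoot_ne_zero : sixthRoot ≠ 0 := exp_ne_zero _

theorem sixthRoot_eq : sixthRoot = 1 / 2 + (√3 / 2 : ℝ) * I := by
  rw [sixthRoot, show (2 * Real.pi * I / (6 : ℕ) : ℂ) = (Real.pi / 3 : ℝ) * I by push_cast; ring,
    exp_mul_I, ← ofReal_cos, ← ofReal_sin, Real.cos_pi_div_three, Real.sin_pi_div_three]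
  push_cast; ring

theorem sixthRoot_sq : sixthRoot ^ 2 = sixthRoot - 1 := by
  have h : ((√3 : ℝ) : ℂ) ^ 2 = 3 := by
    rw [← ofReal_pow, Real.sq_sqrt (by norm_num)]; norm_num
  rw [sixthRoot_eq]; push_cast
  linear_combination (1 / 4 * I ^ 2) * h + 3 / 4 * I_sq

theorem sixthRoot_inv : sixthRoot⁻¹ = 1 - sixthRoot :=
  inv_eq_of_mul_eq_one_right (by linear_combination -sixthRoot_sq)

theorem conj_sixthRoot : (starRingEnd ℂ) sixthRoot = 1 - sixthRoot := by
  rw [sixthRoot_eq]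
  simp only [map_add, map_div₀, map_one, map_ofNat, map_mul, conj_ofReal, conj_I]
  ring

theorem rotAbout_apply (θ : ℝ) (c z : ℂ) : rotAbout θ c z = c + exp (θ * I) * (-c + z) := by
  simp [rotAbout, Circle.coe_exp]

theorem R6_apply (z : ℂ) : R6 z = sixthRoot * z := by
  rw [R6, rotAbout_apply, sixthRoot]; push_cast; ring_nf

theorem R3_apply (z : ℂ) : R3 z = 2 + (sixthRoot - 1) * (z - 2) := by
  rw [R3, rotAbout_apply, ← sixthRoot_sq, sixthRoot, ← exp_nat_mul]; push_cast; ring_nf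

theorem R6_inv_apply (z : ℂ) : R6⁻¹ z = (1 - sixthRoot) * z := by
  rw [← sixthRoot_inv]
  apply R6.injective
  rw [IsometryEquiv.apply_inv_self, R6_apply, mul_inv_cancel_left₀ sixthRoot_ne_zero]

theorem reflX_apply (z : ℂ) : reflX z = (starRingEnd ℂ) z := rfl

theorem reflX_sq : reflX ^ 2 = 1 := by
  ext z; simp [sq, reflX_apply]

theorem alpha_mul_beta : R6⁻¹ * reflX * reflX = R6⁻¹ := by
  rw [mul_assoc, ← sq, reflX_sq, mul_one]

theorem gamma_mul_beta : R3 * reflX * reflX = R3 := by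
  rw [mul_assoc, ← sq, reflX_sq, mul_one]

theorem alpha_sq : (R6⁻¹ * reflX) ^ 2 = 1 := by
  ext z
  simp only [sq, IsometryEquiv.mul_apply, R6_inv_apply, reflX_apply, map_mul, map_sub, map_one,
    conj_sixthRoot, conj_conj, IsometryEquiv.coe_one, id]
  linear_combination -z * sixthRoot_sq

theorem gamma_sq : (R3 * reflX) ^ 2 = 1 := by
  ext z
  simp only [sq, IsometryEquiv.mul_apply, R3_apply, reflX_apply, map_mul, map_sub, map_one,
    map_add, map_ofNat, conj_sixthRoot, conj_conj, IsometryEquiv.coe_one, id]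
  linear_combination (2 - z) * sixthRoot_sq

theorem alpha_mul_beta_pow : (R6⁻¹ * reflX * reflX) ^ 6 = 1 := by
  rw [alpha_mul_beta, inv_pow, inv_eq_one]
  ext z
  have h := IsometryEquiv.zpow_apply_of_mul sixthRoot_ne_zero R6_apply 6 z
  norm_cast at h
  rw [h, isPrimitiveRoot_sixthRoot.pow_eq_one, one_mul, IsometryEquiv.coe_one, id]

theorem R3_pow : R3 ^ 3 = 1 := by
  ext z
  simp only [pow_succ, pow_zero, one_mul, IsometryEquiv.mul_apply, R3_apply,
    IsometryEquiv.coe_one, id]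
  linear_combination (z - 2) * (sixthRoot - 2) * sixthRoot_sq

theorem beta_mul_gamma_pow : (reflX * (R3 * reflX)) ^ 3 = 1 := by
  have h : reflX * (R3 * reflX) = R3⁻¹ := by
    apply eq_inv_of_mul_eq_one_right
    rw [← mul_assoc, ← sq, gamma_sq]
  rw [h, inv_pow, R3_pow, inv_one]

theorem alpha_mul_gamma_sq : (R6⁻¹ * reflX * (R3 * reflX)) ^ 2 = 1 := by
  have h (z : ℂ) : (R6⁻¹ * reflX * (R3 * reflX)) z = 4 - 2 * sixthRoot - z := by
    simp only [IsometryEquiv.mul_apply, R3_apply, R6_inv_apply, reflX_apply, map_mul, map_sub,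
      map_one, map_add, map_ofNat, conj_sixthRoot, conj_conj]
    linear_combination (z - 2) * sixthRoot_sq
  ext z
  rw [sq, IsometryEquiv.mul_apply, h, h, IsometryEquiv.coe_one, id, sub_sub_cancel]

/-- The images of the Coxeter generators. -/
def semikiteReflection : Fin 3 → IsomC := ![R6⁻¹ * reflX, reflX, R3 * reflX]

theorem semikiteReflection_rels (x : FreeGroup (Fin 3)) (hx : x ∈ kitegridRels) :
    FreeGroup.lift semikiteReflection x = 1 := by
  rcases hx with rfl | rfl | rfl | rfl | rfl | rfl <;>
    simp only [map_pow, map_mul, FreeGroup.lift_apply_of, semikiteReflection, Matrix.cons_val]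
  exacts [alpha_sq, reflX_sq, gamma_sq, alpha_mul_beta_pow, beta_mul_gamma_pow, alpha_mul_gamma_sq]

/-- The homomorphism from the Coxeter group to the plane isometries. -/
def semikiteHom : CoxGroup →* IsomC := PresentedGroup.toGroup semikiteReflection_rels

theorem semikiteHom_of (i : Fin 3) :
    semikiteHom (PresentedGroup.of i) = semikiteReflection i :=
  PresentedGroup.toGroup.of _

theorem CoxGroup.closure_generators :
    Subgroup.closure {PresentedGroup.of 0, PresentedGroup.of 1, PresentedGroup.of 2} =
      (⊤ : Subgroup CoxGroup) := by
  rw [← PresentedGroup.closure_range_of kitegridRels]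
  congr 1
  ext x
  simp [Fin.exists_fin_succ, eq_comm]

theorem semikiteHom_range : semikiteHom.range = Subgroup.closure {R6, R3, reflX} := by
  rw [MonoidHom.range_eq_map, ← CoxGroup.closure_generators, MonoidHom.map_closure]
  simp only [Set.image_insert_eq, Set.image_singleton, semikiteHom_of, semikiteReflection,
    Matrix.cons_val]
  apply le_antisymm
  · rw [Subgroup.closure_le]
    have h6 : R6 ∈ Subgroup.closure {R6, R3, reflX} := Subgroup.subset_closure (by simp)
    have h3 : R3 ∈ Subgroup.closure {R6, R3, reflX} := Subgroup.subset_closure (by simp)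
    have hX : reflX ∈ Subgroup.closure {R6, R3, reflX} := Subgroup.subset_closure (by simp)
    rintro _ (rfl | rfl | rfl)
    exacts [mul_mem (inv_mem h6) hX, hX, mul_mem h3 hX]
  · rw [Subgroup.closure_le]
    set K := Subgroup.closure {R6⁻¹ * reflX, reflX, R3 * reflX} with hK
    have hα : R6⁻¹ * reflX ∈ K := Subgroup.subset_closure (by simp)
    have hβ : reflX ∈ K := Subgroup.subset_closure (by simp)
    have hγ : R3 * reflX ∈ K := Subgroup.subset_closure (by simp)
    rintro _ (rfl | rfl | rfl)
    · exact inv_mem_iff.mp ((Subgroup.mul_mem_cancel_right K hβ).mp hα)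
    · exact (Subgroup.mul_mem_cancel_right K hβ).mp hγ
    · exact hβ

theorem CoxGroup.mk_eq_one {x : FreeGroup (Fin 3)} (hx : x ∈ kitegridRels) :
    PresentedGroup.mk kitegridRels x = 1 :=
  PresentedGroup.one_of_mem hx

theorem int_add_mul_sixthRoot_eq_zero {m n : ℤ} (h : (m : ℂ) + n * sixthRoot = 0) :
    m = 0 ∧ n = 0 := by
  rw [sixthRoot_eq] at h
  have hn : n = 0 := by simpa using congrArg im h
  subst hn
  exact ⟨by simpa using h, rfl⟩

theorem semikiteHom_injective : Function.Injective semikiteHom := by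
  rw [injective_iff_map_eq_one]
  intro x hx
  obtain ⟨a, ha⟩ : ∃ a : CoxGroup, a = PresentedGroup.of 0 := ⟨_, rfl⟩
  obtain ⟨b, hb⟩ : ∃ b : CoxGroup, b = PresentedGroup.of 1 := ⟨_, rfl⟩
  obtain ⟨c, hc⟩ : ∃ c : CoxGroup, c = PresentedGroup.of 2 := ⟨_, rfl⟩
  have hab : (a * b) ^ 6 = 1 := by
    rw [ha, hb]; exact CoxGroup.mk_eq_one (by simp [kitegridRels])
  have hφa : semikiteHom a = R6⁻¹ * reflX := by rw [ha]; exact semikiteHom_of 0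
  have hφb : semikiteHom b = reflX := by rw [hb]; exact semikiteHom_of 1
  have hφc : semikiteHom c = R3 * reflX := by rw [hc]; exact semikiteHom_of 2
  obtain ⟨m, n, k, d, hd, rfl⟩ := exists_normalForm (a := a) (b := b) (c := c)
    (by rw [ha]; exact CoxGroup.mk_eq_one (by simp [kitegridRels]))
    (by rw [hb]; exact CoxGroup.mk_eq_one (by simp [kitegridRels]))
    (by rw [hc]; exact CoxGroup.mk_eq_one (by simp [kitegridRels]))
    hab
    (by rw [hb, hc]; exact CoxGroup.mk_eq_one (by simp [kitegridRels]))
    (by rw [ha, hc]; exact CoxGroup.mk_eq_one (by simp [kitegridRels]))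
    (g := x) (by rw [ha, hb, hc, CoxGroup.closure_generators]; trivial)
  have hu (z : ℂ) : (R3 * R6⁻¹ ^ 2) z = (4 - 2 * sixthRoot) + z := by
    simp only [sq, IsometryEquiv.mul_apply, R3_apply, R6_inv_apply]
    linear_combination (z * (sixthRoot - 2)) * sixthRoot_sq
  have hv (z : ℂ) : (R6⁻¹ * R3 * R6⁻¹) z = (2 - 4 * sixthRoot) + z := by
    simp only [IsometryEquiv.mul_apply, R3_apply, R6_inv_apply]
    linear_combination (z * (sixthRoot - 2) + 2) * sixthRoot_sq
  have hr (z : ℂ) : (R6⁻¹ ^ k) z = sixthRoot⁻¹ ^ k * z :=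
    IsometryEquiv.zpow_apply_of_mul (inv_ne_zero sixthRoot_ne_zero)
      (fun z ↦ by rw [R6_inv_apply, sixthRoot_inv]) k z
  have hφd : semikiteHom d = 1 ∨ semikiteHom d = reflX := by
    rcases hd with rfl | rfl <;> simp [hφb]
  have hx' (z : ℂ) : m * (4 - 2 * sixthRoot) + (n * (2 - 4 * sixthRoot) +
      sixthRoot⁻¹ ^ k * semikiteHom d z) = z := by
    have h := DFunLike.congr_fun hx z
    simpa only [IsometryEquiv.coe_one, id, map_mul, map_zpow, map_pow, hφa, hφb, hφc, alpha_mul_beta, gamma_mul_beta,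
      IsometryEquiv.mul_apply, IsometryEquiv.zpow_apply_of_add hu,
      IsometryEquiv.zpow_apply_of_add hv, hr] using h
  have hd0 : semikiteHom d 0 = 0 := by rcases hφd with h | h <;> simp [h, reflX_apply]
  have hd1 : semikiteHom d 1 = 1 := by rcases hφd with h | h <;> simp [h, reflX_apply]
  have h0 := hx' 0
  rw [hd0] at h0
  have hmn := int_add_mul_sixthRoot_eq_zero (m := 4 * m + 2 * n) (n := -2 * m - 4 * n)
    (by push_cast; linear_combination h0)
  obtain ⟨rfl, rfl⟩ : m = 0 ∧ n = 0 := by omega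
  have h1 := hx' 1
  simp only [hd1, Int.cast_zero, zero_mul, zero_add, mul_one] at h1
  have hk : (6 : ℤ) ∣ k :=
    (isPrimitiveRoot_sixthRoot.inv.zpow_eq_one_iff_dvd k).mp h1
  obtain ⟨j, rfl⟩ := hk
  have hrk : (a * b) ^ (6 * j) = 1 := by
    rw [zpow_mul, show (a * b) ^ (6 : ℤ) = 1 by exact_mod_cast hab, one_zpow]
  rcases hd with rfl | rfl
  · simp [hrk]
  · have hI := hx' I
    rw [h1, hφb, reflX_apply, conj_I] at hI
    have := congrArg im hI
    norm_num at this

end PlaneIsometries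

theorem statement_19 :
    ∃ φ : CoxGroup →* IsomC,
      -- the homomorphism determined by `α ↦ R6⁻¹ ∘ β₀`, `β ↦ β₀`, `γ ↦ R3 ∘ β₀`
      -- is well defined,
      φ (PresentedGroup.of 0) = R6⁻¹ * reflX ∧
      φ (PresentedGroup.of 1) = reflX ∧
      φ (PresentedGroup.of 2) = R3 * reflX ∧
      -- injective,
      Function.Injective φ ∧
      -- with image the symmetry group `⟨R6, R3, β₀⟩` of the Semikitegrid;
      φ.range = Subgroup.closure {R6, R3, reflX} ∧
      -- consequently that symmetry group is isomorphic to the Coxeter group: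
      Nonempty (CoxGroup ≃* Subgroup.closure {R6, R3, reflX}) := by
  refine ⟨semikiteHom, semikiteHom_of 0, semikiteHom_of 1, semikiteHom_of 2,
    semikiteHom_injective, semikiteHom_range, ⟨?_⟩⟩
  exact (MonoidHom.ofInjective semikiteHom_injective).trans
    (MulEquiv.subgroupCongr semikiteHom_range)

end
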